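/- Let K be a field containing a primitive 5th root of unity zeta. Consider 5x5 alternating matrices Phi (with rows and columns indexed by Z/5Z) whose entries are homogeneous linear forms in K[w0, w1, w2, w3, w4]. Then the set of such Phi satisfying, for all j, k in Z/5Z: (i) Phi_{j+1,k+1}(w0, w1, w2, w3, w4) = Phi_{j,k}(w1, w2, w3, w4, w0), and (ii) Phi_{j,k}(w0, zeta*w1, zeta^2*w2, zeta^3*w3, zeta^4*w4) = zeta^{-2(j+k)} * Phi_{j,k}(w0, w1, w2, w3, w4), is a 2-dimensional K-vector space, consisting exactly of the matrices Phi(a, b) for a, b in K determined (together with antisymmetry and zero diagonal) by the entries Phi_{j, j+1} = b * w_{j+3} and Phi_{j, j+2} = -a * w_{j+1} for j in Z/5Z (subscripts of w read modulo 5). -/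

import Mathlib

open Matrix MvPolynomial

/-- The Hesse model `Φ(a,b)`: the `5 × 5` alternating matrix of linear forms with
`Φ_{j,j+1} = b·w_{j+3}`, `Φ_{j,j+2} = -a·w_{j+1}` (and hence, by antisymmetry,
`Φ_{j,j+3} = a·w_{j+4}`, `Φ_{j,j+4} = -b·w_{j+2}`), subscripts mod `5`. -/
noncomputable def hesseModel (K : Type*) [Field K] (a b : K) :
    Matrix (ZMod 5) (ZMod 5) (MvPolynomial (ZMod 5) K) :=
  Matrix.of fun j k : ZMod 5 =>
    if k = j + 1 then C b * X (j + 3)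
    else if k = j + 2 then -(C a * X (j + 1))
    else if k = j + 3 then C a * X (j + 4)
    else if k = j + 4 then -(C b * X (j + 2))
    else 0

theorem zmod5_induct {P : ZMod 5 → Prop} (h0 : P 0) (hs : ∀ j, P j → P (j + 1)) : ∀ j, P j := by
  have h1 := hs _ h0
  have h2 := hs _ h1
  have h3 := hs _ h2
  have h4 := hs _ h3
  intro j
  fin_cases j
  · exact h0
  · exact h1
  · exact h2
  · exact h3
  · exact h4

theorem linear_form_eq {K : Type*} [Field K] (P : MvPolynomial (ZMod 5) K)
    (hP : P.IsHomogeneous 1) : ∃ c : ZMod 5 → K, P = ∑ i, C (c i) * X i := by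
  have h : P ∈ homogeneousSubmodule (ZMod 5) K 1 := hP
  rw [homogeneousSubmodule_one_eq_span_X, Submodule.mem_span_range_iff_exists_fun] at h
  obtain ⟨c, hc⟩ := h
  exact ⟨c, by rw [← hc]; simp only [smul_eq_C_mul]⟩

theorem eigen_form {K : Type*} [Field K] {ζ : K} (hζ : IsPrimitiveRoot ζ 5)
    (P : MvPolynomial (ZMod 5) K) (hP : P.IsHomogeneous 1) (m : ZMod 5)
    (h : aeval (fun i : ZMod 5 => (C (ζ ^ i.val) * X i : MvPolynomial (ZMod 5) K)) P
      = C (ζ ^ m.val) * P) : ∃ c : K, P = C c * X m := by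
  obtain ⟨c, rfl⟩ := linear_form_eq P hP
  refine ⟨c m, ?_⟩
  apply Finset.sum_eq_single_of_mem m (Finset.mem_univ _)
  intro i _ him
  have h2 := congrArg (coeff (Finsupp.single i 1)) h
  have key : c i * ζ ^ i.val = ζ ^ m.val * c i := by
    simp only [map_sum, map_mul, aeval_C, aeval_X, coeff_sum, coeff_C_mul, coeff_X,
      algebraMap_eq] at h2
    simpa [Finsupp.single_left_inj, Finset.sum_ite_eq] using h2
  have : c i = 0 := by
    by_contra hc
    apply him
    have : ζ ^ i.val = ζ ^ m.val := by
      apply mul_left_cancel₀ hc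
      rw [key, mul_comm]
    exact ZMod.val_injective 5 (hζ.pow_inj (ZMod.val_lt i) (ZMod.val_lt m) this)
  simp [this]

theorem orbit_form {K : Type*} [Field K]
    (Φ : Matrix (ZMod 5) (ZMod 5) (MvPolynomial (ZMod 5) K))
    (h : ∀ j k, Φ (j + 1) (k + 1) = aeval (fun i : ZMod 5 => X (i + 1)) (Φ j k))
    (d m : ZMod 5) (c : K) (h0 : Φ 0 d = C c * X m) (j : ZMod 5) :
    Φ j (j + d) = C c * X (j + m) := by
  revert j
  apply zmod5_induct
  · simpa using h0
  · intro j hj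
    have := h j (j + d)
    rw [hj] at this
    rw [show j + 1 + d = j + d + 1 by ring, this, show j + 1 + m = j + m + 1 by ring]
    simp [algebraMap_eq]

/-- The `5 × 5` alternating matrices of linear forms that are Heisenberg-invariant
(cyclic condition (i) and diagonal condition (ii)) are exactly the Hesse models
`Φ(a,b)`, and these form a 2-dimensional space (the parametrisation is injective). -/
theorem heisenberg_invariant_models
    (K : Type*) [Field K] (ζ : K) (hζ : IsPrimitiveRoot ζ 5) :
    {Φ : Matrix (ZMod 5) (ZMod 5) (MvPolynomial (ZMod 5) K) |
        Φᵀ = -Φ ∧ (∀ j, Φ j j = 0) ∧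
        (∀ j k, (Φ j k).IsHomogeneous 1) ∧
        (∀ j k, Φ (j + 1) (k + 1) = aeval (fun i : ZMod 5 => X (i + 1)) (Φ j k)) ∧
        (∀ j k, aeval (fun i : ZMod 5 => C (ζ ^ i.val) * X i) (Φ j k) =
          C (ζ ^ ((-2 * (j + k) : ZMod 5)).val) * Φ j k)} =
      {M | ∃ a b : K, M = hesseModel K a b} ∧
    Function.Injective fun p : K × K => hesseModel K p.1 p.2 := by
  constructor
  · ext Φ
    simp only [Set.mem_ofPred_eq]
    constructor
    · rintro ⟨hT, hd, hh, hi, hii⟩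
      obtain ⟨b, hb⟩ := eigen_form hζ _ (hh 0 1) _ (hii 0 1)
      obtain ⟨a, ha⟩ := eigen_form hζ _ (hh 0 2) _ (hii 0 2)
      have hB := orbit_form Φ hi 1 _ b hb
      have hA := orbit_form Φ hi 2 _ a ha
      have hanti : ∀ j k, Φ j k = - Φ k j := fun j k => congrFun (congrFun hT k) j
      refine ⟨-a, b, ?_⟩
      ext1 j k
      obtain ⟨d, rfl⟩ : ∃ d, k = j + d := ⟨k - j, by ring⟩
      have e1 : (-2 * (0 + 1) : ZMod 5) = 3 := by decide
      have e2 : (-2 * (0 + 2) : ZMod 5) = 1 := by decide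
      rw [e1] at hB
      rw [e2] at hA
      have hd' : d = 0 ∨ d = 1 ∨ d = 2 ∨ d = 3 ∨ d = 4 := by revert d; decide
      have n1 : (2 : ZMod 5) ≠ 1 := by decide
      have n2 : (3 : ZMod 5) ≠ 1 := by decide
      have n3 : (3 : ZMod 5) ≠ 2 := by decide
      have n4 : (4 : ZMod 5) ≠ 1 := by decide
      have n5 : (4 : ZMod 5) ≠ 2 := by decide
      have n6 : (4 : ZMod 5) ≠ 3 := by decide
      have z1 : (0 : ZMod 5) ≠ 1 := by decide
      have z2 : (0 : ZMod 5) ≠ 2 := by decide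
      have z3 : (0 : ZMod 5) ≠ 3 := by decide
      have z4 : (0 : ZMod 5) ≠ 4 := by decide
      have q1 : ∀ j : ZMod 5, j + 3 + 2 = j := by decide
      have q2 : ∀ j : ZMod 5, j + 3 + 1 = j + 4 := by decide
      have q3 : ∀ j : ZMod 5, j + 4 + 1 = j := by decide
      have q4 : ∀ j : ZMod 5, j + 4 + 3 = j + 2 := by decide
      simp only [hesseModel, Matrix.of_apply, add_right_inj]
      rcases hd' with rfl | rfl | rfl | rfl | rfl
      · simp only [z1, z2, z3, z4, if_false, add_zero, hd]
      · simp only [if_true, hB]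
      · simp only [n1, if_true, if_false, hA]
        simp
      · simp only [n2, n3, if_true, if_false]
        have := hA (j + 3)
        rw [show j + 3 + 2 = j from q1 j, show j + 3 + 1 = j + 4 from q2 j] at this
        rw [hanti, this]
        simp
      · simp only [n4, n5, n6, if_true, if_false]
        have := hB (j + 4)
        rw [show j + 4 + 1 = j from q3 j, show j + 4 + 3 = j + 2 from q4 j] at this
        rw [hanti, this]
    · rintro ⟨a, b, rfl⟩
      refine ⟨?_, ?_, ?_, ?_, ?_⟩
      · ext1 j k
        obtain ⟨d, rfl⟩ : ∃ d, k = j + d := ⟨k - j, by ring⟩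
        have hd' : d = 0 ∨ d = 1 ∨ d = 2 ∨ d = 3 ∨ d = 4 := by revert d; decide
        simp only [hesseModel, Matrix.transpose_apply, Matrix.neg_apply, Matrix.of_apply,
          add_right_inj, add_assoc, left_eq_add]
        rcases hd' with rfl | rfl | rfl | rfl | rfl
        · simp +decide
        · simp +decide
        · simp +decide
        · simp +decide
        · simp +decide
      · intro j
        simp +decide [hesseModel]
      · intro j k
        have hX : ∀ (c : K) (i : ZMod 5), (C c * X i : MvPolynomial (ZMod 5) K).IsHomogeneous 1 :=
          fun c i => by simpa using (isHomogeneous_C (ZMod 5) c).mul (isHomogeneous_X K i)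
        simp only [hesseModel, Matrix.of_apply]
        split_ifs
        · exact hX _ _
        · exact (hX _ _).neg
        · exact hX _ _
        · exact (hX _ _).neg
        · exact isHomogeneous_zero _ _ _
      · intro j k
        simp only [hesseModel, Matrix.of_apply, add_right_comm j 1, add_left_inj]
        split_ifs <;> simp [algebraMap_eq]
      · intro j k
        have p1 : ∀ j : ZMod 5, -2 * (j + (j + 1)) = j + 3 := by decide
        have p2 : ∀ j : ZMod 5, -2 * (j + (j + 2)) = j + 1 := by decide
        have p3 : ∀ j : ZMod 5, -2 * (j + (j + 3)) = j + 4 := by decide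
        have p4 : ∀ j : ZMod 5, -2 * (j + (j + 4)) = j + 2 := by decide
        simp only [hesseModel, Matrix.of_apply]
        split_ifs with h1 h2 h3 h4
        · subst h1
          rw [p1]
          simp only [map_mul, aeval_C, aeval_X, algebraMap_eq]
          ring
        · subst h2
          rw [p2]
          simp only [map_neg, map_mul, aeval_C, aeval_X, algebraMap_eq]
          ring
        · subst h3
          rw [p3]
          simp only [map_mul, aeval_C, aeval_X, algebraMap_eq]
          ring
        · subst h4
          rw [p4]
          simp only [map_neg, map_mul, aeval_C, aeval_X, algebraMap_eq]
          ring
        · simp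
  · rintro ⟨a, b⟩ ⟨a', b'⟩ h
    have h1 := congrArg (coeff (Finsupp.single (3 : ZMod 5) 1)) (congrFun (congrFun h 0) 1)
    have h2 := congrArg (coeff (Finsupp.single (4 : ZMod 5) 1)) (congrFun (congrFun h 0) 3)
    have n2 : (3 : ZMod 5) ≠ 1 := by decide
    have n3 : (3 : ZMod 5) ≠ 2 := by decide
    simp [hesseModel, coeff_C_mul] at h1
    simp [hesseModel, coeff_C_mul, n2, n3] at h2
    rw [h1, h2]
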